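/- Consider non-uniform random 2-SAT with the uniform ensemble p(n) = (1/n, 1/n, …, 1/n) for every n. Then there is a sharp satisfiability threshold at m*(n) = n: for every constant ε > 0, if m(n) ≤ (1−ε)·n then Pr(Φ satisfiable) = 1−o(1), and if m(n) ≥ (1+ε)·n then Pr(Φ satisfiable) = o(1). -/

import Mathlib

open Finset Filter Asymptotics

open scoped Classical

/-- The probability of drawing a given ordered 2-clause (an ordered pair of literals over
distinct variables); an unordered 2-clause over variables `i ≠ j` then has total probability
`(C/2)·pᵢ·pⱼ` where `C = (1 - ∑ pᵢ²)⁻¹`. -/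
noncomputable def clauseProb2 (n : ℕ) (p : ℕ → ℝ) (c : (Fin n × Bool) × (Fin n × Bool)) : ℝ :=
  if c.1.1 ≠ c.2.1 then
    (1 - ∑ i ∈ Finset.range n, p i ^ 2)⁻¹ / 4 * p c.1.1.1 * p c.2.1.1
  else 0

/-- The probability of drawing a given formula: `m` clauses drawn independently. -/
noncomputable def formulaProb2 (n m : ℕ) (p : ℕ → ℝ)
    (Φ : Fin m → (Fin n × Bool) × (Fin n × Bool)) : ℝ :=
  ∏ j, clauseProb2 n p (Φ j)

/-- Satisfiability of a 2-CNF formula: a literal `(x, b)` is satisfied by an assignment `a`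
iff `a x = b`. -/
def Sat2 {n m : ℕ} (Φ : Fin m → (Fin n × Bool) × (Fin n × Bool)) : Prop :=
  ∃ a : Fin n → Bool, ∀ j, a (Φ j).1.1 = (Φ j).1.2 ∨ a (Φ j).2.1 = (Φ j).2.2

/-- The probability that a non-uniform random 2-SAT formula with `n` variables, `m` clauses
and variable distribution `p` is satisfiable. -/
noncomputable def probSat2 (n m : ℕ) (p : ℕ → ℝ) : ℝ :=
  ∑ Φ : Fin m → (Fin n × Bool) × (Fin n × Bool),
    if Sat2 Φ then formulaProb2 n m p Φ else 0

/-- The probability that a non-uniform random 2-SAT formula is unsatisfiable. -/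
noncomputable def probUnsat2 (n m : ℕ) (p : ℕ → ℝ) : ℝ :=
  ∑ Φ : Fin m → (Fin n × Bool) × (Fin n × Bool),
    if ¬ Sat2 Φ then formulaProb2 n m p Φ else 0

/-- The normalization constant `C = (1 - ∑ pᵢ²)⁻¹`. -/
noncomputable def Cconst (n : ℕ) (p : ℕ → ℝ) : ℝ :=
  (1 - ∑ i ∈ Finset.range n, p i ^ 2)⁻¹

/-- The maximum clause probability `q_max = (C/2)·p₁·p₂`. -/
noncomputable def qmax2 (n : ℕ) (p : ℕ → ℝ) : ℝ :=
  Cconst n p / 2 * p 0 * p 1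

/-- `p n` is a probability vector on `n` variables (indexed `0,…,n-1`), sorted decreasingly,
with all entries positive. -/
def ProbEnsemble (p : ℕ → ℕ → ℝ) : Prop :=
  ∀ n, 1 ≤ n →
    (∑ i ∈ Finset.range n, p n i = 1) ∧
    (∀ i j, i ≤ j → j < n → p n j ≤ p n i) ∧
    (∀ i, i < n → 0 < p n i)

abbrev Lt (n : ℕ) := Fin n × Bool

def ng {n : ℕ} (l : Lt n) : Lt n := (l.1, !l.2)

noncomputable def qq (n : ℕ) : ℝ := 1 / (2 * n * (n - 1))

noncomputable def cw (n : ℕ) (c : Lt n × Lt n) : ℝ := if c.1.1 ≠ c.2.1 then qq n / 2 else 0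

noncomputable def Prb (n : ℕ) {ι : Type} [Fintype ι] [DecidableEq ι]
    (E : (ι → Lt n × Lt n) → Prop) : ℝ :=
  ∑ Φ : ι → Lt n × Lt n, if E Φ then ∏ j, cw n (Φ j) else 0

def mk2 {n : ℕ} (c : Lt n × Lt n) : Sym2 (Lt n) := s(c.1, c.2)

def Prop2 {n : ℕ} (c : Sym2 (Lt n)) : Prop := ∃ x y : Lt n, c = s(x, y) ∧ x.1 ≠ y.1

lemma qq_nonneg (n : ℕ) : 0 ≤ qq n := by
  unfold qq
  rcases Nat.eq_zero_or_pos n with h | h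
  · simp [h]
  · have : (1 : ℝ) ≤ n := by exact_mod_cast h
    apply div_nonneg zero_le_one
    apply mul_nonneg <;> linarith

lemma cw_nonneg (n : ℕ) (c : Lt n × Lt n) : 0 ≤ cw n c := by
  unfold cw
  have := qq_nonneg n
  split_ifs <;> linarith

lemma clauseProb2_eq {n : ℕ} (hn : 2 ≤ n) (c : Lt n × Lt n) :
    clauseProb2 n (fun _ => (n : ℝ)⁻¹) c = cw n c := by
  unfold clauseProb2 cw qq
  split_ifs
  · have : (2 : ℝ) ≤ n := by exact_mod_cast hn
    have h1 : (n : ℝ) - 1 ≠ 0 := by linarith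
    have h0 : (n : ℝ) ≠ 0 := by linarith
    have : (1 - ∑ i ∈ Finset.range n, ((n : ℝ)⁻¹) ^ 2) = (n - 1) / n := by
      simp; field_simp
    rw [this]
    field_simp
    norm_num
  · rfl

lemma probSat2_eq {n : ℕ} (hn : 2 ≤ n) (m : ℕ) :
    probSat2 n m (fun _ => (n : ℝ)⁻¹) = Prb n (ι := Fin m) (fun Φ => Sat2 Φ) := by
  unfold probSat2 Prb formulaProb2
  simp_rw [clauseProb2_eq hn]

lemma cw_sum {n : ℕ} (hn : 2 ≤ n) : ∑ c, cw n c = 1 := by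
  have hr : (2 : ℝ) ≤ n := by exact_mod_cast hn
  unfold cw
  rw [Fintype.sum_prod_type]
  have : ∀ x : Lt n, ∑ y : Lt n, (if x.1 ≠ y.1 then qq n / 2 else 0) = (n - 1) * qq n := by
    intro x
    rw [Fintype.sum_prod_type]
    have : ∀ a : Fin n, (∑ b : Bool, if x.1 ≠ ((a, b) : Lt n).1 then qq n / 2 else 0) =
        if x.1 ≠ a then qq n else 0 := by
      intro a
      rw [Fintype.sum_bool]
      by_cases h : x.1 = a <;> simp [h]
    rw [Finset.sum_congr rfl fun a _ => this a]
    rw [← Finset.sum_filter, Finset.sum_const, Finset.filter_ne,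
      Finset.card_erase_of_mem (Finset.mem_univ _)]
    simp only [Finset.card_univ, Fintype.card_fin, nsmul_eq_mul]
    rw [Nat.cast_sub (by omega)]
    push_cast
    rfl
  simp only [this]
  simp [qq]
  have h1 : (n : ℝ) - 1 ≠ 0 := by linarith
  have h0 : (n : ℝ) ≠ 0 := by linarith
  field_simp

section
variable {n : ℕ} {ι : Type} [Fintype ι] [DecidableEq ι]

lemma Prb_nonneg (E : (ι → Lt n × Lt n) → Prop) : 0 ≤ Prb n E := by
  unfold Prb
  apply Finset.sum_nonneg
  intro Φ _
  split_ifs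
  · exact Finset.prod_nonneg fun j _ => cw_nonneg n _
  · exact le_rfl

lemma Prb_mono {E F : (ι → Lt n × Lt n) → Prop}
    (h : ∀ Φ, (∀ j, (Φ j).1.1 ≠ (Φ j).2.1) → E Φ → F Φ) : Prb n E ≤ Prb n F := by
  unfold Prb
  apply Finset.sum_le_sum
  intro Φ _
  have hp : 0 ≤ ∏ j, cw n (Φ j) := Finset.prod_nonneg fun j _ => cw_nonneg n _
  by_cases hΦ : ∀ j, (Φ j).1.1 ≠ (Φ j).2.1
  · have := h Φ hΦ
    split_ifs <;> first | exact le_rfl | exact hp | tauto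
  · push Not at hΦ
    obtain ⟨j, hj⟩ := hΦ
    have : ∏ j, cw n (Φ j) = 0 := Finset.prod_eq_zero (Finset.mem_univ j) (by simp [cw, hj])
    simp [this]

lemma Prb_or (E F : (ι → Lt n × Lt n) → Prop) :
    Prb n (fun Φ => E Φ ∨ F Φ) ≤ Prb n E + Prb n F := by
  unfold Prb
  rw [← Finset.sum_add_distrib]
  apply Finset.sum_le_sum
  intro Φ _
  have hp : 0 ≤ ∏ j, cw n (Φ j) := Finset.prod_nonneg fun j _ => cw_nonneg n _
  by_cases h1 : E Φ <;> by_cases h2 : F Φ <;> simp [h1, h2, hp]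

lemma Prb_exists {D : Type} [Fintype D] (F : D → (ι → Lt n × Lt n) → Prop) :
    Prb n (fun Φ => ∃ d, F d Φ) ≤ ∑ d, Prb n (F d) := by
  unfold Prb
  rw [Finset.sum_comm]
  apply Finset.sum_le_sum
  intro Φ _
  have hp : 0 ≤ ∏ j, cw n (Φ j) := Finset.prod_nonneg fun j _ => cw_nonneg n _
  split_ifs with h
  · obtain ⟨d, hd⟩ := h
    calc _ = (if F d Φ then ∏ j, cw n (Φ j) else 0) := by simp [hd]
      _ ≤ _ := Finset.single_le_sum (f := fun d => if F d Φ then ∏ j, cw n (Φ j) else 0)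
        (fun i _ => by split_ifs <;> simp [hp]) (Finset.mem_univ d)
  · exact Finset.sum_nonneg (fun i _ => by split_ifs <;> simp [hp])

lemma Prb_pi (S : ι → Lt n × Lt n → Prop) :
    Prb n (fun Φ : ι → Lt n × Lt n => ∀ j, S j (Φ j)) =
      ∏ j, ∑ c, if S j c then cw n c else 0 := by
  unfold Prb
  rw [Finset.prod_univ_sum, Fintype.piFinset_univ]
  apply Finset.sum_congr rfl
  intro Φ _
  by_cases h : ∀ j, S j (Φ j)
  · simp [h]
  · rw [if_neg h]
    push Not at h
    obtain ⟨j, hj⟩ := h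
    exact (Finset.prod_eq_zero (Finset.mem_univ j) (by simp [hj])).symm

lemma Prb_compl (hn : 2 ≤ n) (E : (ι → Lt n × Lt n) → Prop) :
    Prb n E + Prb n (fun Φ => ¬ E Φ) = 1 := by
  have h1 : Prb n (fun Φ : ι → Lt n × Lt n => ∀ j : ι, True) = 1 := by
    rw [Prb_pi (fun _ _ => True)]
    simp [cw_sum hn]
  rw [← h1]
  unfold Prb
  rw [← Finset.sum_add_distrib]
  apply Finset.sum_congr rfl
  intro Φ _
  by_cases h : E Φ <;> simp [h]

lemma sum_eq_le (c : Sym2 (Lt n)) : (∑ x, if mk2 x = c then cw n x else 0) ≤ qq n := by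
  induction c using Sym2.ind with
  | _ a b =>
  have h0 := qq_nonneg n
  rw [← Finset.sum_filter]
  have : (Finset.univ.filter fun x : Lt n × Lt n => mk2 x = s(a, b)) ⊆ {(a, b), (b, a)} := by
    intro x
    simp only [Finset.mem_filter, Finset.mem_univ, true_and, mk2, Sym2.eq_iff, Finset.mem_insert,
      Finset.mem_singleton, Prod.ext_iff]
    tauto
  calc _ ≤ ∑ x ∈ ({(a, b), (b, a)} : Finset (Lt n × Lt n)), cw n x :=
        Finset.sum_le_sum_of_subset_of_nonneg this fun i _ _ => cw_nonneg n i
    _ ≤ ∑ x ∈ ({(a, b), (b, a)} : Finset (Lt n × Lt n)), qq n / 2 := by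
        apply Finset.sum_le_sum
        intro x _
        unfold cw
        split_ifs <;> linarith
    _ ≤ qq n := by
        rw [Finset.sum_const, nsmul_eq_mul]
        have : ((({(a, b), (b, a)} : Finset (Lt n × Lt n)).card : ℕ) : ℝ) ≤ 2 := by
          exact_mod_cast Finset.card_le_two
        nlinarith

lemma sum_eq_ge {c : Sym2 (Lt n)} (hc : Prop2 c) :
    qq n ≤ (∑ x, if mk2 x = c then cw n x else 0) := by
  obtain ⟨a, b, rfl, hab⟩ := hc
  rw [← Finset.sum_filter]
  have : ({(a, b), (b, a)} : Finset (Lt n × Lt n)) ⊆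
      (Finset.univ.filter fun x : Lt n × Lt n => mk2 x = s(a, b)) := by
    intro x
    simp only [Finset.mem_filter, Finset.mem_univ, true_and, mk2, Sym2.eq_iff, Finset.mem_insert,
      Finset.mem_singleton, Prod.ext_iff]
    tauto
  refine le_trans ?_ (Finset.sum_le_sum_of_subset_of_nonneg this fun i _ _ => cw_nonneg n i)
  rw [Finset.sum_pair]
  · simp [cw, hab, hab.symm]
  · intro h
    apply hab
    have := congrArg (fun z => z.1.1) h
    exact this

lemma sum_notin_le (hn : 2 ≤ n) (A : Finset (Sym2 (Lt n))) (hA : ∀ c ∈ A, Prop2 c) :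
    (∑ x, if mk2 x ∉ A then cw n x else 0) ≤ 1 - qq n * A.card := by
  have h1 : (∑ x, if mk2 x ∉ A then cw n x else 0) + (∑ x, if mk2 x ∈ A then cw n x else 0)
      = 1 := by
    rw [← cw_sum hn, ← Finset.sum_add_distrib]
    apply Finset.sum_congr rfl
    intro x _
    by_cases h : mk2 x ∈ A <;> simp [h]
  have h2 : (∑ x, if mk2 x ∈ A then cw n x else 0)
      = ∑ c ∈ A, ∑ x, if mk2 x = c then cw n x else 0 := by
    rw [Finset.sum_comm]
    apply Finset.sum_congr rfl
    intro x _
    rw [Finset.sum_ite_eq]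
  have h3 : (A.card : ℝ) * qq n ≤ ∑ c ∈ A, ∑ x, if mk2 x = c then cw n x else 0 := by
    rw [← nsmul_eq_mul]
    exact Finset.card_nsmul_le_sum _ _ _ fun c hc => sum_eq_ge (hA c hc)
  linarith

lemma Prb_core (hn : 2 ≤ n) (P A : Finset (Sym2 (Lt n))) (hA : ∀ c ∈ A, Prop2 c) :
    Prb n (fun Φ : ι → Lt n × Lt n => (∀ c ∈ P, ∃ j, mk2 (Φ j) = c) ∧
      ∀ c ∈ A, ∀ j, mk2 (Φ j) ≠ c) ≤
    (Fintype.card ι * qq n) ^ P.card * (1 - qq n * A.card) ^ (Fintype.card ι - P.card) := by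
  have hA0 : 0 ≤ 1 - qq n * A.card :=
    le_trans (Finset.sum_nonneg fun i _ => by
      have := cw_nonneg n i
      split_ifs <;> simp [this]) (sum_notin_le hn A hA)
  have hq := qq_nonneg n
  let S : (P → ι) → ι → Lt n × Lt n → Prop := fun g j x =>
    (∀ c : P, g c = j → mk2 x = c) ∧ ((∀ c : P, g c ≠ j) → mk2 x ∉ A)
  have hB : 0 ≤ qq n ^ P.card * (1 - qq n * A.card) ^ (Fintype.card ι - P.card) := by positivity
  have key : ∀ g : P → ι,
      Prb n (fun Φ : ι → Lt n × Lt n => Function.Injective g ∧ ∀ j, S g j (Φ j)) ≤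
      qq n ^ P.card * (1 - qq n * A.card) ^ (Fintype.card ι - P.card) := by
    intro g
    by_cases hg : Function.Injective g
    · simp only [hg, true_and]
      rw [Prb_pi]
      calc _ ≤ ∏ j : ι, (if j ∈ Finset.univ.image g then qq n else (1 - qq n * A.card)) := by
            apply Finset.prod_le_prod
            · intro j _
              exact Finset.sum_nonneg fun i _ => by
                split_ifs
                · exact cw_nonneg n i
                · exact le_rfl
            · intro j _
              split_ifs with hj
              · simp only [Finset.mem_image, Finset.mem_univ, true_and] at hj
                obtain ⟨c, hc⟩ := hj
                refine le_trans (Finset.sum_le_sum fun x _ => ?_) (sum_eq_le (c : Sym2 (Lt n)))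
                have := cw_nonneg n x
                by_cases h : S g j x
                · rw [if_pos h, if_pos (h.1 c hc)]
                · rw [if_neg h]; split_ifs <;> simp [this]
              · simp only [Finset.mem_image, Finset.mem_univ, true_and, not_exists] at hj
                refine le_trans (Finset.sum_le_sum fun x _ => ?_) (sum_notin_le hn A hA)
                have := cw_nonneg n x
                by_cases h : S g j x
                · rw [if_pos h, if_pos (h.2 hj)]
                · rw [if_neg h]; split_ifs <;> simp [this]
        _ = _ := by
            rw [Finset.prod_ite, Finset.prod_const, Finset.prod_const]
            have h1 : (Finset.univ.filter fun j => j ∈ Finset.univ.image g).card = P.card := by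
              rw [Finset.filter_mem_eq_inter, Finset.univ_inter,
                Finset.card_image_of_injective _ hg]
              simp
            have h2 : (Finset.univ.filter fun j => j ∉ Finset.univ.image g).card =
                Fintype.card ι - P.card := by
              rw [← h1, ← Finset.card_univ,
                ← Finset.card_filter_add_card_filter_not (s := Finset.univ) (fun j => j ∈ Finset.univ.image g)]
              omega
            rw [h1, h2]
    · simp only [hg, false_and]
      simpa [Prb] using hB
  calc _ ≤ Prb n (fun Φ : ι → Lt n × Lt n => ∃ g : P → ι, Function.Injective g ∧
        ∀ j, S g j (Φ j)) := by
        apply Prb_mono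
        rintro Φ - ⟨h1, h2⟩
        choose g hg using h1
        refine ⟨fun c => g c c.2, ?_, ?_⟩
        · intro c d hcd
          apply Subtype.ext
          rw [← hg c c.2, ← hg d d.2]
          simp only at hcd
          rw [hcd]
        · intro j
          refine ⟨?_, ?_⟩
          · rintro c rfl
            exact hg c c.2
          · intro _ hmem
            exact h2 _ hmem j rfl
    _ ≤ ∑ g : P → ι, Prb n (fun Φ : ι → Lt n × Lt n => Function.Injective g ∧
        ∀ j, S g j (Φ j)) := Prb_exists _
    _ ≤ ∑ g : P → ι, qq n ^ P.card * (1 - qq n * A.card) ^ (Fintype.card ι - P.card) :=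
        Finset.sum_le_sum fun g _ => key g
    _ = _ := by
        rw [Finset.sum_const, Finset.card_univ, Fintype.card_fun, Fintype.card_coe, nsmul_eq_mul]
        push_cast
        ring
end

def fresh {n : ℕ} (S : Finset (Lt n)) (U : List (Lt n)) (w : Lt n) : Prop :=
  (∀ x ∈ S, x.1 ≠ w.1) ∧ ∀ x ∈ U, x.1 ≠ w.1

structure DInv {n : ℕ} (S : Finset (Lt n)) (U : List (Lt n)) (P A : Finset (Sym2 (Lt n))) :
    Prop where
  chain : List.IsChain (fun u v => s(ng v, u) ∈ P) U
  nodup : (U.map Prod.fst).Nodup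
  disj : ∀ u ∈ U, ∀ x ∈ S, x.1 ≠ u.1
  done : ∀ x ∈ S, ∀ w, fresh S U w → s(ng x, w) ∈ A
  old : ∀ c ∈ P, ∀ l ∈ c, ¬ fresh S U l
  oldA : ∀ c ∈ A, ∃ l ∈ c, ¬ fresh S U l
  propA : ∀ c ∈ A, Prop2 c
  card : P.card ≤ S.card + U.length

lemma ng_fst {n : ℕ} (x : Lt n) : (ng x).1 = x.1 := rfl

lemma ng_ng {n : ℕ} (x : Lt n) : ng (ng x) = x := by simp [ng]

lemma ng_ne {n : ℕ} (x : Lt n) : ng x ≠ x := by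
  intro h
  have := congrArg Prod.snd h
  simp [ng] at this

lemma ng_inj {n : ℕ} {x y : Lt n} (h : ng x = ng y) : x = y := by
  rw [← ng_ng x, h, ng_ng]

def freshV {n : ℕ} (S : Finset (Lt n)) (U : List (Lt n)) : Finset (Fin n) :=
  Finset.univ \ (S.image Prod.fst ∪ (U.map Prod.fst).toFinset)

lemma mem_freshV {n : ℕ} {S : Finset (Lt n)} {U : List (Lt n)} {w : Lt n} :
    w.1 ∈ freshV S U ↔ fresh S U w := by
  unfold freshV fresh
  simp only [Finset.mem_sdiff, Finset.mem_univ, true_and, Finset.mem_union, Finset.mem_image,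
    List.mem_toFinset, List.mem_map, not_or, not_exists, not_and]

lemma freshV_card {n : ℕ} (S : Finset (Lt n)) (U : List (Lt n)) :
    n ≤ (freshV S U).card + (S.card + U.length) := by
  unfold freshV
  have h1 := Finset.le_card_sdiff (S.image Prod.fst ∪ (U.map Prod.fst).toFinset)
    (Finset.univ : Finset (Fin n))
  have h2 := Finset.card_union_le (S.image Prod.fst) (U.map Prod.fst).toFinset
  have h3 : (S.image Prod.fst).card ≤ S.card := Finset.card_image_le
  have h4 := List.toFinset_card_le (U.map Prod.fst)
  rw [List.length_map] at h4
  rw [Finset.card_univ, Fintype.card_fin] at h1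
  omega

lemma DInv.done_card {n : ℕ} {S : Finset (Lt n)} {U : List (Lt n)} {P A : Finset (Sym2 (Lt n))}
    (h : DInv S U P A) : S.card * (2 * (n - S.card - U.length)) ≤ A.card := by
  have h1 := freshV_card S U
  have h2 : (S ×ˢ (freshV S U ×ˢ (Finset.univ : Finset Bool))).card ≤ A.card := by
    apply Finset.card_le_card_of_injOn (fun p => s(ng p.1, p.2))
    · rintro ⟨x, w⟩ hp
      simp only [Finset.coe_product, Set.mem_prod, Finset.mem_coe] at hp
      exact h.done x hp.1 w (mem_freshV.1 hp.2.1)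
    · rintro ⟨x, w⟩ hp ⟨x', w'⟩ hp' he
      simp only [Finset.coe_product, Set.mem_prod, Finset.mem_coe] at hp hp'
      simp only [Sym2.eq_iff] at he
      rcases he with he | he
      · rw [ng_inj he.1, he.2]
      · exfalso
        apply (mem_freshV.1 hp'.2.1).1 x hp.1
        rw [← he.1, ng_fst]
  simp only [Finset.card_product, Finset.card_univ, Fintype.card_bool] at h2
  refine le_trans ?_ h2
  apply Nat.mul_le_mul_left
  omega

lemma DInv.next {n : ℕ} {P A : Finset (Sym2 (Lt n))} {s0 K : ℕ} (hsn : s0 + 2 ≤ n)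
    (hAc : A.card < s0 * (2 * (n - s0 - K))) : ∀ (U : List (Lt n)) (S : Finset (Lt n)),
    DInv S U P A → S.card < s0 → U.length < K →
    ∃ (S' : Finset (Lt n)) (u : Lt n) (R : List (Lt n)) (w : Lt n), DInv S' (u :: R) P A ∧
      S'.card < s0 ∧ fresh S' (u :: R) w ∧ s(ng u, w) ∉ A := by
  intro U
  induction U with
  | nil =>
    intro S h hS hK
    have h1 := freshV_card S []
    simp only [List.length_nil] at h1
    obtain ⟨a, ha, b, hb, hab⟩ := Finset.one_lt_card.1 (show 1 < (freshV S []).card by omega)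
    have hfa : fresh S [] ((a, true) : Lt n) := mem_freshV.1 ha
    have hfb : fresh S [] ((b, true) : Lt n) := mem_freshV.1 hb
    have hmono : ∀ l, fresh S [(a, true)] l → fresh S [] l := fun l hl => ⟨hl.1, by simp⟩
    refine ⟨S, (a, true), [], (b, true), ⟨by simp, by simp, ?_, ?_, ?_, ?_, h.propA, ?_⟩, hS, ?_, ?_⟩
    · intro u hu x hx
      simp only [List.mem_singleton] at hu
      subst hu
      exact hfa.1 x hx
    · exact fun x hx w hw => h.done x hx w (hmono w hw)
    · exact fun c hc l hl hf => h.old c hc l hl (hmono l hf)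
    · intro c hc
      obtain ⟨l, hl, hf⟩ := h.oldA c hc
      exact ⟨l, hl, fun hf' => hf (hmono l hf')⟩
    · have := h.card
      simp only [List.length_nil, List.length_singleton] at *
      omega
    · refine ⟨hfb.1, ?_⟩
      simpa using hab
    · intro hA
      obtain ⟨l, hl, hf⟩ := h.oldA _ hA
      rw [Sym2.mem_iff] at hl
      rcases hl with rfl | rfl
      · exact hf hfa
      · exact hf hfb
  | cons u R ih =>
    intro S h hS hK
    by_cases hex : ∃ w, fresh S (u :: R) w ∧ s(ng u, w) ∉ A
    · obtain ⟨w, hw, hwA⟩ := hex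
      exact ⟨S, u, R, w, h, hS, hw, hwA⟩
    · push Not at hex
      have huS : u ∉ S := fun hu => h.disj u (by simp) u hu rfl
      have hmono : ∀ l, fresh (insert u S) R l ↔ fresh S (u :: R) l := by
        intro l
        unfold fresh
        simp only [Finset.mem_insert, List.mem_cons, forall_eq_or_imp]
        tauto
      have hc : (insert u S).card = S.card + 1 := Finset.card_insert_of_notMem huS
      have hnd := h.nodup
      rw [List.map_cons, List.nodup_cons] at hnd
      have hI : DInv (insert u S) R P A := by
        refine ⟨h.chain.tail, hnd.2, ?_, ?_, ?_, ?_, h.propA, ?_⟩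
        · intro v hv x hx
          rw [Finset.mem_insert] at hx
          rcases hx with rfl | hx
          · intro he
            apply hnd.1
            rw [he]
            exact List.mem_map_of_mem hv
          · exact h.disj v (by simp [hv]) x hx
        · intro x hx w hw
          rw [hmono] at hw
          rw [Finset.mem_insert] at hx
          rcases hx with rfl | hx
          · exact hex w hw
          · exact h.done x hx w hw
        · intro c hc l hl
          rw [hmono]
          exact h.old c hc l hl
        · intro c hc
          obtain ⟨l, hl, hf⟩ := h.oldA c hc
          exact ⟨l, hl, by rwa [hmono]⟩
        · have := h.card
          rw [hc]
          simp only [List.length_cons] at this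
          omega
      simp only [List.length_cons] at hK
      apply ih (insert u S) hI _ (by omega)
      by_contra hcon
      have hs : (insert u S).card = s0 := by omega
      have := hI.done_card
      rw [hs] at this
      have h2 : s0 * (2 * (n - s0 - K)) ≤ s0 * (2 * (n - s0 - R.length)) := by
        apply Nat.mul_le_mul_left
        omega
      omega

section
variable {n : ℕ} {ι : Type} [Fintype ι] [DecidableEq ι]

def HasPath (K : ℕ) (Φ : ι → Lt n × Lt n) : Prop :=
  ∃ U : List (Lt n), K ≤ U.length ∧ (U.map Prod.fst).Nodup ∧
    List.IsChain (fun u v => ∃ j, mk2 (Φ j) = s(ng v, u)) U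

lemma DInv.yes {S : Finset (Lt n)} {u w : Lt n} {R : List (Lt n)} {P A : Finset (Sym2 (Lt n))}
    (h : DInv S (u :: R) P A) (hw : fresh S (u :: R) w) :
    s(ng u, w) ∉ P ∧ DInv S (w :: u :: R) (insert s(ng u, w) P) A := by
  have hmono : ∀ l, fresh S (w :: u :: R) l → fresh S (u :: R) l := by
    intro l hl
    exact ⟨hl.1, fun x hx => hl.2 x (by simp at hx ⊢; tauto)⟩
  have hP : s(ng u, w) ∉ P := fun hP => h.old _ hP w (by simp) hw
  refine ⟨hP, ?_, ?_, ?_, ?_, ?_, ?_, h.propA, ?_⟩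
  · rw [List.isChain_cons_cons]
    refine ⟨by simp, ?_⟩
    exact h.chain.imp fun a b hab => by simp [hab]
  · rw [List.map_cons, List.nodup_cons]
    refine ⟨?_, h.nodup⟩
    intro hm
    rw [List.mem_map] at hm
    obtain ⟨x, hx, hxw⟩ := hm
    exact hw.2 x hx hxw
  · intro v hv x hx
    rw [List.mem_cons] at hv
    rcases hv with rfl | hv
    · exact hw.1 x hx
    · exact h.disj v hv x hx
  · exact fun x hx l hl => h.done x hx l (hmono l hl)
  · intro c hc l hl hf
    rw [Finset.mem_insert] at hc
    rcases hc with rfl | hc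
    · rw [Sym2.mem_iff] at hl
      rcases hl with rfl | rfl
      · exact hf.2 u (by simp) rfl
      · exact hf.2 l (by simp) rfl
    · exact h.old c hc l hl (hmono l hf)
  · intro c hc
    obtain ⟨l, hl, hf⟩ := h.oldA c hc
    exact ⟨l, hl, fun hf' => hf (hmono l hf')⟩
  · rw [Finset.card_insert_of_notMem hP]
    have := h.card
    simp only [List.length_cons] at *
    omega

lemma DInv.no {S : Finset (Lt n)} {u w : Lt n} {R : List (Lt n)} {P A : Finset (Sym2 (Lt n))}
    (h : DInv S (u :: R) P A) (hw : fresh S (u :: R) w) :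
    DInv S (u :: R) P (insert s(ng u, w) A) := by
  refine ⟨h.chain, h.nodup, h.disj, ?_, h.old, ?_, ?_, h.card⟩
  · exact fun x hx l hl => Finset.mem_insert_of_mem (h.done x hx l hl)
  · intro c hc
    rw [Finset.mem_insert] at hc
    rcases hc with rfl | hc
    · exact ⟨ng u, by simp, fun hf => hf.2 u (by simp) rfl⟩
    · exact h.oldA c hc
  · intro c hc
    rw [Finset.mem_insert] at hc
    rcases hc with rfl | hc
    · exact ⟨_, _, rfl, hw.2 u (by simp)⟩
    · exact h.propA c hc

lemma dfs_bound (hn : 2 ≤ n) {s0 K Q : ℕ} (hsn : s0 + 2 ≤ n)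
    (hQ : Q ≤ s0 * (2 * (n - s0 - K))) (hM : s0 + K ≤ Fintype.card ι) (θ : ℝ) (hθ : 0 ≤ θ)
    (ρ β : ℝ) (hρ : ρ = Fintype.card ι * qq n * Real.exp (-θ))
    (hβ : β = Real.exp (-(qq n * (Fintype.card ι - (s0 + K))))) :
    ∀ (q : ℕ) (S : Finset (Lt n)) (U : List (Lt n)) (P A : Finset (Sym2 (Lt n))),
    DInv S U P A → S.card < s0 → P.card + A.card + q = Q →
    Prb n (fun Φ : ι → Lt n × Lt n => ¬ HasPath K Φ ∧ (∀ c ∈ P, ∃ j, mk2 (Φ j) = c) ∧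
      ∀ c ∈ A, ∀ j, mk2 (Φ j) ≠ c) ≤
    Real.exp (θ * (s0 + K)) * ρ ^ P.card * β ^ A.card * (ρ + β) ^ q := by
  have hq := qq_nonneg n
  have hρ0 : 0 ≤ ρ := by rw [hρ]; positivity
  have hβ0 : 0 ≤ β := by rw [hβ]; positivity
  intro q
  induction q with
  | zero =>
    intro S U P A h hS hc
    by_cases hU : K ≤ U.length
    · refine le_trans (b := 0) ?_ (by positivity)
      have : Prb n (fun Φ : ι → Lt n × Lt n => False) = 0 := by simp [Prb]
      rw [← this]
      apply Prb_mono
      rintro Φ - ⟨h1, h2, -⟩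
      exact h1 ⟨U, hU, h.nodup, h.chain.imp fun a b hab => h2 _ hab⟩
    · have hPk : P.card ≤ s0 + K := by have := h.card; omega
      refine le_trans (Prb_mono (F := fun Φ : ι → Lt n × Lt n => (∀ c ∈ P, ∃ j, mk2 (Φ j) = c) ∧
        ∀ c ∈ A, ∀ j, mk2 (Φ j) ≠ c) fun Φ _ hh => hh.2) ?_
      refine le_trans (Prb_core hn P A h.propA) ?_
      have hA0 : 0 ≤ 1 - qq n * A.card :=
        le_trans (Finset.sum_nonneg fun i _ => by
          have := cw_nonneg n i
          split_ifs <;> simp [this]) (sum_notin_le hn A h.propA)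
      have e1 : (1 - qq n * A.card) ^ (Fintype.card ι - P.card) ≤ β ^ A.card := by
        calc (1 - qq n * A.card) ^ (Fintype.card ι - P.card)
            ≤ Real.exp (-(qq n * A.card)) ^ (Fintype.card ι - P.card) := by
              apply pow_le_pow_left₀ hA0
              exact Real.one_sub_le_exp_neg _
          _ = Real.exp (-(qq n * A.card * (Fintype.card ι - P.card))) := by
              rw [← Real.exp_nat_mul, Nat.cast_sub (by omega)]
              congr 1; ring
          _ ≤ Real.exp (-(qq n * A.card * (Fintype.card ι - (s0 + K)))) := by
              apply Real.exp_le_exp.2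
              have : (P.card : ℝ) ≤ s0 + K := by exact_mod_cast hPk
              have h3 : 0 ≤ qq n * A.card := by positivity
              nlinarith
          _ = β ^ A.card := by
              rw [hβ, ← Real.exp_nat_mul]
              congr 1; ring
      have e2 : (Fintype.card ι * qq n) ^ P.card ≤ Real.exp (θ * (s0 + K)) * ρ ^ P.card := by
        rw [hρ, mul_pow _ (Real.exp _), ← Real.exp_nat_mul, mul_left_comm, ← Real.exp_add]
        apply le_mul_of_one_le_right (by positivity)
        apply Real.one_le_exp
        have : (P.card : ℝ) ≤ s0 + K := by exact_mod_cast hPk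
        nlinarith
      rw [pow_zero, mul_one]
      exact mul_le_mul e2 e1 (by positivity) (by positivity)
  | succ q ih =>
    intro S U P A h hS hc
    by_cases hU : K ≤ U.length
    · refine le_trans (b := 0) ?_ (by positivity)
      have : Prb n (fun Φ : ι → Lt n × Lt n => False) = 0 := by simp [Prb]
      rw [← this]
      apply Prb_mono
      rintro Φ - ⟨h1, h2, -⟩
      exact h1 ⟨U, hU, h.nodup, h.chain.imp fun a b hab => h2 _ hab⟩
    · obtain ⟨S', u, R, w, hI, hS', hw, hwA⟩ :=
        DInv.next (s0 := s0) (K := K) hsn (by omega) U S h hS (by omega)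
      obtain ⟨hwP, hY⟩ := hI.yes hw
      have hN := hI.no hw
      have b1 := ih S' _ _ _ hY hS' (by rw [Finset.card_insert_of_notMem hwP]; omega)
      have b2 := ih S' _ _ _ hN hS' (by rw [Finset.card_insert_of_notMem hwA]; omega)
      rw [Finset.card_insert_of_notMem hwP] at b1
      rw [Finset.card_insert_of_notMem hwA] at b2
      refine le_trans (Prb_mono ?_) (le_trans (Prb_or _ _) (le_trans (add_le_add b1 b2) ?_))
      · rintro Φ - ⟨h1, h2, h3⟩
        by_cases hj : ∃ j, mk2 (Φ j) = s(ng u, w)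
        · left
          refine ⟨h1, ?_, h3⟩
          intro c hc
          rw [Finset.mem_insert] at hc
          rcases hc with rfl | hc
          · exact hj
          · exact h2 c hc
        · right
          push Not at hj
          refine ⟨h1, h2, ?_⟩
          intro c hc
          rw [Finset.mem_insert] at hc
          rcases hc with rfl | hc
          · exact hj
          · exact h3 c hc
      · apply le_of_eq
        ring

lemma dfs_final (hn : 2 ≤ n) {s0 K Q : ℕ} (hs : 0 < s0) (hsn : s0 + 2 ≤ n)
    (hQ : Q ≤ s0 * (2 * (n - s0 - K))) (hM : s0 + K ≤ Fintype.card ι) (θ : ℝ) (hθ : 0 ≤ θ) :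
    Prb n (fun Φ : ι → Lt n × Lt n => ¬ HasPath K Φ) ≤
    Real.exp (θ * (s0 + K)) * (Fintype.card ι * qq n * Real.exp (-θ) +
      Real.exp (-(qq n * (Fintype.card ι - (s0 + K))))) ^ Q := by
  have h0 : DInv (∅ : Finset (Lt n)) [] ∅ ∅ := by
    constructor <;> simp
  have := dfs_bound (ι := ι) hn hsn hQ hM θ hθ _ _ rfl rfl Q ∅ [] ∅ ∅ h0 (by simpa using hs)
    (by simp)
  simpa using this
end

section
variable {n : ℕ} {ι κ : Type} [Fintype ι] [DecidableEq ι] [Fintype κ] [DecidableEq κ]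

def SatG (Φ : ι → Lt n × Lt n) : Prop :=
  ∃ a : Fin n → Bool, ∀ j, a (Φ j).1.1 = (Φ j).1.2 ∨ a (Φ j).2.1 = (Φ j).2.2

lemma Prb_equiv (e : κ ≃ ι) (E : (ι → Lt n × Lt n) → Prop) :
    Prb n E = Prb n (fun Φ : κ → Lt n × Lt n => E (Φ ∘ e.symm)) := by
  unfold Prb
  apply Fintype.sum_equiv (e.symm.arrowCongr (Equiv.refl _))
  intro Φ
  have h1 : (e.symm.arrowCongr (Equiv.refl _) Φ) ∘ e.symm = Φ := by
    ext j <;> simp [Equiv.arrowCongr]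
  beta_reduce
  rw [h1]
  congr 1
  apply Fintype.prod_equiv e.symm
  intro j
  simp [Equiv.arrowCongr]

lemma Prb_sum (E : (ι ⊕ κ → Lt n × Lt n) → Prop) :
    Prb n E = ∑ Φ₁ : ι → Lt n × Lt n, (∏ j, cw n (Φ₁ j)) *
      Prb n (fun Φ₂ : κ → Lt n × Lt n => E (Sum.elim Φ₁ Φ₂)) := by
  unfold Prb
  simp_rw [Finset.mul_sum]
  rw [← Fintype.sum_prod_type']
  apply Fintype.sum_equiv (Equiv.sumArrowEquivProdArrow _ _ _)
  intro Φ
  have : Sum.elim ((Equiv.sumArrowEquivProdArrow ι κ (Lt n × Lt n)) Φ).1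
    ((Equiv.sumArrowEquivProdArrow ι κ (Lt n × Lt n)) Φ).2 = Φ := by
    ext (j | j) <;> rfl
  simp only [this, Fintype.prod_sum_type]
  split_ifs
  · rfl
  · simp

lemma Prb_le_one (hn : 2 ≤ n) (E : (ι → Lt n × Lt n) → Prop) : Prb n E ≤ 1 := by
  have := Prb_compl hn E
  have := Prb_nonneg (fun Φ => ¬ E Φ)
  linarith

lemma Prb_sum_le (hn : 2 ≤ n) (E : (ι ⊕ κ → Lt n × Lt n) → Prop) (F : (ι → Lt n × Lt n) → Prop)
    (δ : ℝ) (hδ : 0 ≤ δ) (h : ∀ Φ₁, F Φ₁ →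
      Prb n (fun Φ₂ : κ → Lt n × Lt n => E (Sum.elim Φ₁ Φ₂)) ≤ δ) :
    Prb n E ≤ Prb n (fun Φ => ¬ F Φ) + δ := by
  have hF := Prb_le_one hn F
  have hpos := Prb_nonneg F
  rw [Prb_sum]
  calc _ ≤ ∑ Φ₁ : ι → Lt n × Lt n, ((if ¬ F Φ₁ then ∏ j, cw n (Φ₁ j) else 0) +
        (if F Φ₁ then ∏ j, cw n (Φ₁ j) else 0) * δ) := by
        apply Finset.sum_le_sum
        intro Φ _
        have hp : 0 ≤ ∏ j, cw n (Φ j) := Finset.prod_nonneg fun j _ => cw_nonneg n _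
        by_cases hf : F Φ
        · simp only [hf, not_true_eq_false, if_false, if_true, zero_add]
          exact mul_le_mul_of_nonneg_left (h Φ hf) hp
        · simp only [hf, not_false_eq_true, if_false, if_true, zero_mul, add_zero]
          exact mul_le_of_le_one_right hp (Prb_le_one hn _)
    _ = Prb n (fun Φ => ¬ F Φ) + Prb n F * δ := by
        rw [Finset.sum_add_distrib, ← Finset.sum_mul]
        unfold Prb
        congr 1
        apply Finset.sum_congr rfl
        intro Φ _
        by_cases hf : F Φ <;> simp [hf]
    _ ≤ _ := by nlinarith

lemma Prb_avoid (hn : 2 ≤ n) (f : Lt n → Lt n) (hf : Function.Injective f)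
    (hf1 : ∀ x, (f x).1 = x.1) (V : List (Lt n)) (hV : (V.map Prod.fst).Nodup) (h : ℕ)
    (hh : h ≤ V.length) :
    Prb n (fun Φ : κ → Lt n × Lt n => ∀ j, ¬ ∃ x ∈ V, ∃ y ∈ V, x ≠ y ∧ Φ j = (f x, f y)) ≤
      (1 - h * (h - 1) * (qq n / 2)) ^ (Fintype.card κ) := by
  rw [Prb_pi (fun _ c => ¬ ∃ x ∈ V, ∃ y ∈ V, x ≠ y ∧ c = (f x, f y)), Finset.prod_const,
    Finset.card_univ]
  apply pow_le_pow_left₀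
  · apply Finset.sum_nonneg
    intro i _
    have := cw_nonneg n i
    split_ifs <;> simp [this]
  have hq := qq_nonneg n
  have hVn : V.Nodup := List.Nodup.of_map _ hV
  have hcard : V.toFinset.card = V.length := List.toFinset_card_of_nodup hVn
  set Z : Finset (Lt n × Lt n) := V.toFinset.offDiag.image (fun p => (f p.1, f p.2)) with hZ
  have hmem : ∀ c, (∃ x ∈ V, ∃ y ∈ V, x ≠ y ∧ c = (f x, f y)) ↔ c ∈ Z := by
    intro c
    simp only [hZ, Finset.mem_image, Finset.mem_offDiag, List.mem_toFinset]
    constructor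
    · rintro ⟨x, hx, y, hy, hxy, rfl⟩
      exact ⟨(x, y), ⟨hx, hy, hxy⟩, rfl⟩
    · rintro ⟨⟨x, y⟩, ⟨hx, hy, hxy⟩, rfl⟩
      exact ⟨x, hx, y, hy, hxy, rfl⟩
  have hZc : Z.card = V.length * V.length - V.length := by
    rw [hZ, Finset.card_image_of_injective, Finset.offDiag_card, hcard]
    rintro ⟨a, b⟩ ⟨c, d⟩ he
    simp only [Prod.mk.injEq] at he
    rw [hf he.1, hf he.2]
  have hcw : ∀ c ∈ Z, cw n c = qq n / 2 := by
    intro c hc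
    rw [← hmem] at hc
    obtain ⟨x, hx, y, hy, hxy, rfl⟩ := hc
    have : x.1 ≠ y.1 := fun he => hxy (List.inj_on_of_nodup_map hV hx hy he)
    simp [cw, hf1, this]
  simp_rw [hmem]
  have h1 : (∑ c, if c ∉ Z then cw n c else 0) + (∑ c, if c ∈ Z then cw n c else 0) = 1 := by
    rw [← cw_sum hn, ← Finset.sum_add_distrib]
    apply Finset.sum_congr rfl
    intro x _
    by_cases h : x ∈ Z <;> simp [h]
  have h2 : (∑ c, if c ∈ Z then cw n c else 0) = Z.card * (qq n / 2) := by
    rw [← Finset.sum_filter, Finset.filter_mem_eq_inter, Finset.univ_inter,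
      Finset.sum_congr rfl hcw, Finset.sum_const, nsmul_eq_mul]
  have h3 : (h : ℝ) * (h - 1) ≤ Z.card := by
    rw [hZc, Nat.cast_sub (Nat.le_mul_self _)]
    push_cast
    have a1 : (h : ℝ) ≤ V.length := by exact_mod_cast hh
    rcases Nat.eq_zero_or_pos h with h0 | h0
    · subst h0
      have : V.length ≤ V.length * V.length := Nat.le_mul_self _
      have : (V.length : ℝ) ≤ V.length * V.length := by exact_mod_cast this
      simpa using this
    · have : (1 : ℝ) ≤ h := by exact_mod_cast h0
      nlinarith
  have h4 : (h : ℝ) * (h - 1) * (qq n / 2) ≤ Z.card * (qq n / 2) :=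
    mul_le_mul_of_nonneg_right h3 (by linarith)
  linarith

lemma sprinkle (hn : 2 ≤ n) (h : ℕ) (Φ₁ : ι → Lt n × Lt n) (hp : HasPath (2 * h) Φ₁) :
    Prb n (fun Φ₂ : κ → Lt n × Lt n => SatG (Sum.elim Φ₁ Φ₂)) ≤
      2 * (1 - h * (h - 1) * (qq n / 2)) ^ (Fintype.card κ) := by
  obtain ⟨U, hK, hnd, hch⟩ := hp
  have hU : U.take h ++ U.drop h = U := List.take_append_drop h U
  have hnd' := hnd
  rw [← hU, List.map_append, List.nodup_append] at hnd'
  have b1 := Prb_avoid (κ := κ) hn ng (fun _ _ => ng_inj) ng_fst (U.take h) hnd'.1 h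
    (by rw [List.length_take]; omega)
  have b2 := Prb_avoid (κ := κ) hn id (fun _ _ => id) (fun _ => rfl) (U.drop h) hnd'.2.1 h
    (by rw [List.length_drop]; omega)
  rw [two_mul]
  refine le_trans (Prb_mono ?_) (le_trans (Prb_or _ _) (add_le_add b1 b2))
  rintro Φ₂ - ⟨a, ha⟩
  have hpw : List.Pairwise (fun u v : Lt n => a v.1 = v.2 → a u.1 = u.2) U := by
    have : IsTrans (Lt n) (fun u v : Lt n => a v.1 = v.2 → a u.1 = u.2) :=
      ⟨fun x y z h1 h2 h3 => h1 (h2 h3)⟩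
    rw [← List.isChain_iff_pairwise]
    apply hch.imp
    rintro u v ⟨j, hj⟩ hv
    have := ha (Sum.inl j)
    simp only [Sum.elim_inl] at this
    simp only [mk2, Sym2.eq_iff] at hj
    rcases hj with ⟨h1, h2⟩ | ⟨h1, h2⟩
    · rw [h1, h2] at this
      simp only [ng, hv] at this
      simpa using this
    · rw [h1, h2] at this
      simp only [ng, hv] at this
      simpa using this
  rw [← hU, List.pairwise_append] at hpw
  by_cases hall : ∃ v ∈ U.drop h, a v.1 = v.2
  · left
    obtain ⟨v, hv, hav⟩ := hall
    rintro j ⟨x, hx, y, hy, -, he⟩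
    have := ha (Sum.inr j)
    simp only [Sum.elim_inr, he, ng, hpw.2.2 x hx v hv hav, hpw.2.2 y hy v hv hav] at this
    simp at this
  · right
    push Not at hall
    rintro j ⟨x, hx, y, hy, -, he⟩
    have := ha (Sum.inr j)
    simp only [Sum.elim_inr, he, id, hall x hx, hall y hy] at this
    simp at this

lemma upper_bound (hn : 2 ≤ n) {s0 h Q m₁ m₂ : ℕ} (hs : 0 < s0) (hsn : s0 + 2 ≤ n)
    (hQ : Q ≤ s0 * (2 * (n - s0 - 2 * h))) (hM : s0 + 2 * h ≤ m₁) (θ : ℝ) (hθ : 0 ≤ θ)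
    (hκ : (h : ℝ) * (h - 1) * (qq n / 2) ≤ 1) :
    probSat2 n (m₁ + m₂) (fun _ => (n : ℝ)⁻¹) ≤
    Real.exp (θ * (s0 + 2 * h)) * (m₁ * qq n * Real.exp (-θ) +
      Real.exp (-(qq n * (m₁ - (s0 + 2 * h))))) ^ Q +
      2 * (1 - h * (h - 1) * (qq n / 2)) ^ m₂ := by
  rw [probSat2_eq hn, Prb_equiv (finSumFinEquiv (m := m₁) (n := m₂))]
  have hb := dfs_final (ι := Fin m₁) hn hs hsn hQ (by simpa using hM) θ hθ
  rw [Fintype.card_fin] at hb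
  push_cast at hb
  refine le_trans ?_ (add_le_add_left hb _)
  refine le_trans (Prb_mono (F := SatG) ?_)
    (Prb_sum_le hn _ (HasPath (2 * h)) _ ?_ ?_)
  · rintro Φ - ⟨a, ha⟩
    refine ⟨a, fun j => ?_⟩
    have := ha (finSumFinEquiv j)
    simpa using this
  · have : 0 ≤ (1 - h * (h - 1) * (qq n / 2)) := by linarith
    positivity
  · intro Φ₁ hp
    have := sprinkle (κ := Fin m₂) hn h Φ₁ hp
    rwa [Fintype.card_fin] at this
end

lemma nat_floor_lim {a : ℝ} (ha : 0 ≤ a) :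
    Tendsto (fun n : ℕ => ((⌊a * n⌋₊ : ℕ) : ℝ) / n) atTop (nhds a) :=
  (tendsto_nat_floor_mul_div_atTop ha).comp tendsto_natCast_atTop_atTop

lemma inv_lim : Tendsto (fun n : ℕ => 1 / (n : ℝ)) atTop (nhds 0) :=
  tendsto_one_div_atTop_nhds_zero_nat

lemma qq_lim : Tendsto (fun n : ℕ => (n : ℝ) ^ 2 * qq n) atTop (nhds (1 / 2)) := by
  have h : Tendsto (fun n : ℕ => 1 / (2 * (1 - 1 / (n : ℝ)))) atTop
      (nhds (1 / (2 * (1 - 0)))) := by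
    apply Tendsto.div tendsto_const_nhds
    · exact (tendsto_const_nhds.sub inv_lim).const_mul 2
    · norm_num
  rw [sub_zero, mul_one] at h
  refine h.congr' ?_
  filter_upwards [eventually_ge_atTop 2] with n hn
  have hr : (2 : ℝ) ≤ n := by exact_mod_cast hn
  have h1 : (n : ℝ) - 1 ≠ 0 := by linarith
  have h0 : (n : ℝ) ≠ 0 := by linarith
  unfold qq
  field_simp

lemma first_term {e δ : ℝ} (he : 0 < e) (he1 : e ≤ 1 / 2) (hδ : δ = e ^ 2 / 100) :
    Tendsto (fun n : ℕ => Real.exp (e / 2 * (⌊δ * n⌋₊ + 2 * ⌊δ ^ 2 * n⌋₊)) *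
      (⌊(1 + e) * n⌋₊ * qq n * Real.exp (-(e / 2)) +
      Real.exp (-(qq n * (⌊(1 + e) * n⌋₊ - (⌊δ * n⌋₊ + 2 * ⌊δ ^ 2 * n⌋₊))))) ^
        (⌊δ * n⌋₊ * (2 * (n - ⌊δ * n⌋₊ - 2 * ⌊δ ^ 2 * n⌋₊)))) atTop (nhds 0) := by
  have hδ0 : 0 < δ := by rw [hδ]; positivity
  have hδ1 : δ ≤ 1 / 400 := by rw [hδ]; nlinarith
  have hδ2 : δ ^ 2 ≤ δ / 400 := by nlinarith
  set s : ℕ → ℝ := fun n => ((⌊δ * n⌋₊ : ℕ) : ℝ) with hs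
  set h : ℕ → ℝ := fun n => ((⌊δ ^ 2 * n⌋₊ : ℕ) : ℝ) with hh
  set M : ℕ → ℝ := fun n => ((⌊(1 + e) * n⌋₊ : ℕ) : ℝ) with hMdef
  set E := Real.exp (-(e / 2)) with hE
  set x : ℕ → ℝ := fun n => qq n * (M n - (s n + 2 * h n)) with hx
  set Qr : ℕ → ℝ := fun n => s n * (2 * (n - s n - 2 * h n)) with hQr
  set G : ℕ → ℝ := fun n => e / 2 * (s n + 2 * h n) + Qr n * (M n * qq n * E - x n / (1 + x n))
    with hG
  have ls : Tendsto (fun n => s n / n) atTop (nhds δ) := nat_floor_lim hδ0.le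
  have lh : Tendsto (fun n => h n / n) atTop (nhds (δ ^ 2)) := nat_floor_lim (by positivity)
  have lM : Tendsto (fun n => M n / n) atTop (nhds (1 + e)) := nat_floor_lim (by positivity)
  have lnx : Tendsto (fun n : ℕ => (n : ℝ) * x n) atTop
      (nhds (1 / 2 * (1 + e - (δ + 2 * δ ^ 2)))) := by
    have := qq_lim.mul (lM.sub (ls.add (lh.const_mul 2)))
    refine this.congr' ?_
    filter_upwards [eventually_ge_atTop 2] with n hn
    have h0 : (n : ℝ) ≠ 0 := by positivity
    simp only [hx]
    field_simp
  have lx : Tendsto x atTop (nhds 0) := by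
    have := lnx.mul inv_lim
    rw [mul_zero] at this
    refine this.congr' ?_
    filter_upwards [eventually_ge_atTop 2] with n hn
    have h0 : (n : ℝ) ≠ 0 := by positivity
    field_simp
  have lQ : Tendsto (fun n => Qr n / n ^ 2) atTop
      (nhds (δ * (2 * (1 - δ - 2 * δ ^ 2)))) := by
    have := ls.mul ((((tendsto_const_nhds (x := (1 : ℝ))).sub ls).sub (lh.const_mul 2)).const_mul 2)
    refine this.congr' ?_
    filter_upwards [eventually_ge_atTop 2] with n hn
    have h0 : (n : ℝ) ≠ 0 := by positivity
    simp only [hQr]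
    field_simp
  have lG : Tendsto (fun n => G n / n) atTop (nhds (e / 2 * (δ + 2 * δ ^ 2) +
      δ * (2 * (1 - δ - 2 * δ ^ 2)) * ((1 + e) * (1 / 2) * E -
        1 / 2 * (1 + e - (δ + 2 * δ ^ 2)) / (1 + 0)))) := by
    have := ((ls.add (lh.const_mul 2)).const_mul (e / 2)).add
      (lQ.mul (((lM.mul qq_lim).mul_const E).sub
        (lnx.div ((tendsto_const_nhds (x := (1 : ℝ))).add lx) (by norm_num))))
    refine this.congr' ?_
    filter_upwards [eventually_ge_atTop 2] with n hn
    have h0 : (n : ℝ) ≠ 0 := by positivity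
    simp only [hG, Pi.div_apply]
    field_simp
  set L := (e / 2 * (δ + 2 * δ ^ 2) +
      δ * (2 * (1 - δ - 2 * δ ^ 2)) * ((1 + e) * (1 / 2) * E -
        1 / 2 * (1 + e - (δ + 2 * δ ^ 2)) / (1 + 0))) with hL
  have hLneg : L < 0 := by
    have hE1 : E ≤ 1 / (1 + e / 2) := by
      rw [hE, Real.exp_neg, inv_eq_one_div]
      apply one_div_le_one_div_of_le (by positivity)
      linarith [Real.add_one_le_exp (e / 2)]
    have hE2 : (1 + e) * E - (1 + e) ≤ - (e / 2) - e ^ 2 / 5 := by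
      have : (1 + e) * E ≤ (1 + e) * (1 / (1 + e / 2)) :=
        mul_le_mul_of_nonneg_left hE1 (by positivity)
      have h2 : (1 + e) * (1 / (1 + e / 2)) ≤ 1 + e / 2 - e ^ 2 / 5 := by
        rw [mul_one_div, div_le_iff₀ (by positivity)]
        nlinarith [sq_nonneg e, mul_pos he he]
      linarith
    have hLe : L = δ * (e / 2 * (1 + 2 * δ) + (1 - δ - 2 * δ ^ 2) *
        ((1 + e) * E - (1 + e) + (δ + 2 * δ ^ 2))) := by
      rw [hL]; ring
    rw [hLe]
    apply mul_neg_of_pos_of_neg hδ0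
    have hy : e ^ 2 = 100 * δ := by rw [hδ]; ring
    have : (1 - δ - 2 * δ ^ 2) * ((1 + e) * E - (1 + e) + (δ + 2 * δ ^ 2)) ≤
        (1 - δ - 2 * δ ^ 2) * (- (e / 2) - e ^ 2 / 5 + (δ + 2 * δ ^ 2)) := by
      apply mul_le_mul_of_nonneg_left _ (by nlinarith)
      linarith
    refine lt_of_le_of_lt (add_le_add_right this _) ?_
    rw [hy]
    nlinarith [mul_pos he hδ0, mul_pos hδ0 hδ0, mul_pos (mul_pos hδ0 hδ0) hδ0,
      mul_pos he (mul_pos hδ0 hδ0), pow_pos hδ0 4]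
  have lGbot : Tendsto G atTop atBot := by
    have := lG.neg_mul_atTop hLneg (tendsto_natCast_atTop_atTop (R := ℝ))
    refine this.congr' ?_
    filter_upwards [eventually_ge_atTop 2] with n hn
    have h0 : (n : ℝ) ≠ 0 := by positivity
    field_simp
  have lexp : Tendsto (fun n => Real.exp (G n)) atTop (nhds 0) :=
    Real.tendsto_exp_atBot.comp lGbot
  refine squeeze_zero' ?_ ?_ lexp
  · filter_upwards with n
    have := qq_nonneg n
    positivity
  · have hx0 : ∀ᶠ n in atTop, -1 < x n := lx.eventually (lt_mem_nhds (by norm_num))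
    filter_upwards [hx0] with n hxn
    have hq := qq_nonneg n
    have hQ : (((⌊δ * n⌋₊ * (2 * (n - ⌊δ * n⌋₊ - 2 * ⌊δ ^ 2 * n⌋₊)) : ℕ)) : ℝ) = Qr n := by
      have a1 : (⌊δ * n⌋₊ : ℝ) ≤ δ * n := Nat.floor_le (by positivity)
      have a2 : (⌊δ ^ 2 * n⌋₊ : ℝ) ≤ δ ^ 2 * n := Nat.floor_le (by positivity)
      have a3 : ((⌊δ * n⌋₊ + 2 * ⌊δ ^ 2 * n⌋₊ : ℕ) : ℝ) ≤ n := by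
        push_cast
        have : (0 : ℝ) ≤ n := by positivity
        nlinarith
      have a4 : ⌊δ * n⌋₊ + 2 * ⌊δ ^ 2 * n⌋₊ ≤ n := by exact_mod_cast a3
      rw [Nat.cast_mul, Nat.cast_mul, Nat.cast_sub (by omega), Nat.cast_sub (by omega)]
      push_cast
      rfl
    have hbase : M n * qq n * E + Real.exp (-(x n)) ≤
        Real.exp (M n * qq n * E - x n / (1 + x n)) := by
      have h1 : Real.exp (-(x n)) ≤ 1 / (1 + x n) := by
        rw [Real.exp_neg, inv_eq_one_div]
        apply one_div_le_one_div_of_le (by linarith)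
        linarith [Real.add_one_le_exp (x n)]
      have h2 : 1 / (1 + x n) = 1 - x n / (1 + x n) := by
        have : 1 + x n ≠ 0 := by linarith
        field_simp
        ring
      have h3 := Real.add_one_le_exp (M n * qq n * E - x n / (1 + x n))
      linarith
    have hE0 : 0 ≤ E := (Real.exp_pos _).le
    have hM0 : 0 ≤ M n := Nat.cast_nonneg _
    calc _ = Real.exp (e / 2 * (s n + 2 * h n)) * (M n * qq n * E + Real.exp (-(x n))) ^
          (⌊δ * n⌋₊ * (2 * (n - ⌊δ * n⌋₊ - 2 * ⌊δ ^ 2 * n⌋₊))) := rfl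
      _ ≤ Real.exp (e / 2 * (s n + 2 * h n)) *
          Real.exp (M n * qq n * E - x n / (1 + x n)) ^
          (⌊δ * n⌋₊ * (2 * (n - ⌊δ * n⌋₊ - 2 * ⌊δ ^ 2 * n⌋₊))) := by
          apply mul_le_mul_of_nonneg_left _ (Real.exp_pos _).le
          exact pow_le_pow_left₀ (by positivity) hbase _
      _ = Real.exp (G n) := by
          rw [← Real.exp_nat_mul, hQ, ← Real.exp_add]

lemma upper_part {ε : ℝ} (hε : 0 < ε) (m : ℕ → ℕ)
    (hm : ∀ᶠ n : ℕ in atTop, (1 + ε) * n ≤ (m n : ℝ)) :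
    Tendsto (fun n => probSat2 n (m n) fun _ => (n : ℝ)⁻¹) atTop (nhds 0) := by
  obtain ⟨e, he, he1, heε⟩ : ∃ e : ℝ, 0 < e ∧ e ≤ 1 / 2 ∧ 2 * e ≤ ε :=
    ⟨min ε 1 / 2, by positivity, by linarith [min_le_right ε 1], by linarith [min_le_left ε 1]⟩
  obtain ⟨δ, hδ⟩ : ∃ δ : ℝ, δ = e ^ 2 / 100 := ⟨_, rfl⟩
  have hδ0 : 0 < δ := by rw [hδ]; positivity
  have hδ1 : δ ≤ 1 / 400 := by rw [hδ]; nlinarith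
  have hδ2 : δ ^ 2 ≤ δ / 400 := by nlinarith
  have l1 := first_term he he1 hδ
  have lh : Tendsto (fun n : ℕ => ((⌊δ ^ 2 * n⌋₊ : ℕ) : ℝ) / n) atTop (nhds (δ ^ 2)) :=
    nat_floor_lim (by positivity)
  have lκ : Tendsto (fun n : ℕ => (⌊δ ^ 2 * n⌋₊ : ℝ) * (⌊δ ^ 2 * n⌋₊ - 1) * (qq n / 2)) atTop
      (nhds (δ ^ 2 * (δ ^ 2 - 0) * (1 / 2 / 2))) := by
    have := (lh.mul (lh.sub inv_lim)).mul (qq_lim.div_const 2)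
    refine this.congr' ?_
    filter_upwards [eventually_ge_atTop 2] with n hn
    have h0 : (n : ℝ) ≠ 0 := by positivity
    field_simp
  have hδ4 : 0 < δ ^ 4 := by positivity
  have hδ41 : δ ^ 4 ≤ 1 := pow_le_one₀ hδ0.le (by linarith)
  have hκ1 := lκ.eventually (lt_mem_nhds (show δ ^ 4 / 8 < _ by ring_nf; linarith))
  have hκ2 := lκ.eventually (gt_mem_nhds (show _ < (1 : ℝ) by ring_nf; linarith))
  have lm2 : Tendsto (fun n => m n - ⌊(1 + e) * n⌋₊) atTop atTop := by
    rw [← tendsto_natCast_atTop_iff (R := ℝ)]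
    refine tendsto_atTop_mono' _ ?_
      ((tendsto_natCast_atTop_atTop (R := ℝ)).const_mul_atTop he)
    filter_upwards [hm] with n hmn
    have a1 : (⌊(1 + e) * n⌋₊ : ℝ) ≤ (1 + e) * n := Nat.floor_le (by positivity)
    have a2 : (m n : ℝ) ≤ ((m n - ⌊(1 + e) * n⌋₊ : ℕ) : ℝ) + ⌊(1 + e) * n⌋₊ := by
      exact_mod_cast (by omega : m n ≤ m n - ⌊(1 + e) * n⌋₊ + ⌊(1 + e) * n⌋₊)
    have : (0 : ℝ) ≤ n := by positivity
    nlinarith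
  have l2 : Tendsto (fun n => 2 * (1 - δ ^ 4 / 8) ^ (m n - ⌊(1 + e) * (n : ℝ)⌋₊)) atTop
      (nhds (2 * 0)) :=
    ((tendsto_pow_atTop_nhds_zero_of_lt_one (by linarith) (by linarith)).comp lm2).const_mul 2
  have l3 := l1.add l2
  rw [mul_zero, add_zero] at l3
  have hs1 : ∀ᶠ n : ℕ in atTop, 1 ≤ δ * (n : ℝ) :=
    ((tendsto_natCast_atTop_atTop (R := ℝ)).const_mul_atTop hδ0).eventually_ge_atTop 1
  refine squeeze_zero' ?_ ?_ l3
  · filter_upwards [eventually_ge_atTop 2] with n hn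
    rw [probSat2_eq hn]
    exact Prb_nonneg _
  · filter_upwards [eventually_ge_atTop 4, hm, hκ1, hκ2, hs1] with n hn hmn k1 k2 k3
    have hn4 : (4 : ℝ) ≤ n := by exact_mod_cast hn
    have a1 : (⌊(1 + e) * n⌋₊ : ℝ) ≤ (1 + e) * n := Nat.floor_le (by positivity)
    have a2 : (⌊δ * n⌋₊ : ℝ) ≤ δ * n := Nat.floor_le (by positivity)
    have a3 : (⌊δ ^ 2 * n⌋₊ : ℝ) ≤ δ ^ 2 * n := Nat.floor_le (by positivity)
    have b1 : ⌊(1 + e) * (n : ℝ)⌋₊ ≤ m n := by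
      have : (⌊(1 + e) * n⌋₊ : ℝ) ≤ m n := by nlinarith
      exact_mod_cast this
    have b2 : n ≤ ⌊(1 + e) * (n : ℝ)⌋₊ := Nat.le_floor (by nlinarith)
    have b3 : ⌊δ * (n : ℝ)⌋₊ + 2 ≤ n := by
      have : ((⌊δ * n⌋₊ + 2 : ℕ) : ℝ) ≤ n := by
        push_cast
        nlinarith
      exact_mod_cast this
    have b4 : ⌊δ * (n : ℝ)⌋₊ + 2 * ⌊δ ^ 2 * (n : ℝ)⌋₊ ≤ n := by
      have : ((⌊δ * n⌋₊ + 2 * ⌊δ ^ 2 * n⌋₊ : ℕ) : ℝ) ≤ n := by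
        push_cast
        nlinarith
      exact_mod_cast this
    have := upper_bound (n := n) (by omega) (s0 := ⌊δ * (n : ℝ)⌋₊) (h := ⌊δ ^ 2 * (n : ℝ)⌋₊)
      (m₁ := ⌊(1 + e) * (n : ℝ)⌋₊) (m₂ := m n - ⌊(1 + e) * (n : ℝ)⌋₊)
      (Nat.floor_pos.2 k3) b3 le_rfl (by omega) (e / 2) (by positivity) k2.le
    rw [Nat.add_sub_cancel' b1] at this
    refine le_trans this (add_le_add_right ?_ _)
    apply mul_le_mul_of_nonneg_left _ (by norm_num)
    apply pow_le_pow_left₀ (by linarith)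
    linarith

section
variable {n : ℕ} {ι : Type} [Fintype ι] [DecidableEq ι]

def Imp (Φ : ι → Lt n × Lt n) (u v : Lt n) : Prop := ∃ j, mk2 (Φ j) = s(ng u, v)

lemma Imp.contra {Φ : ι → Lt n × Lt n} {u v : Lt n} (h : Imp Φ u v) : Imp Φ (ng v) (ng u) := by
  obtain ⟨j, hj⟩ := h
  exact ⟨j, by rw [hj, ng_ng, Sym2.eq_swap]⟩

lemma reach_contra {Φ : ι → Lt n × Lt n} {u v : Lt n} (h : Relation.ReflTransGen (Imp Φ) u v) :
    Relation.ReflTransGen (Imp Φ) (ng v) (ng u) := by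
  induction h with
  | refl => exact .refl
  | tail _ hbc ih => exact .head hbc.contra ih

lemma sat_of_no_cycle (Φ : ι → Lt n × Lt n)
    (h : ∀ x, ¬ (Relation.ReflTransGen (Imp Φ) x (ng x) ∧
      Relation.ReflTransGen (Imp Φ) (ng x) x)) : SatG Φ := by
  let good : Set (Lt n) → Prop := fun S =>
    (∀ x ∈ S, ∀ y, Relation.ReflTransGen (Imp Φ) x y → y ∈ S) ∧ ∀ x ∈ S, ng x ∉ S
  obtain ⟨S, hS⟩ := (Set.toFinite {S | good S}).exists_maximal ⟨∅, by simp [good]⟩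
  have hg : good S := hS.1
  have ext : ∀ x, x ∉ S → ng x ∉ S → ¬ Relation.ReflTransGen (Imp Φ) x (ng x) → False := by
    intro x hx hnx hr
    have hg' : good (S ∪ {y | Relation.ReflTransGen (Imp Φ) x y}) := by
      constructor
      · rintro z (hz | hz) y hzy
        · exact Or.inl (hg.1 z hz y hzy)
        · exact Or.inr (Relation.ReflTransGen.trans hz hzy)
      · rintro z (hz | hz) (hz' | hz')
        · exact hg.2 z hz hz'
        · have := reach_contra hz'
          rw [ng_ng] at this
          exact hnx (hg.1 z hz _ this)
        · exact hnx (hg.1 _ hz' _ (reach_contra hz))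
        · have := reach_contra hz'
          rw [ng_ng] at this
          exact hr (Relation.ReflTransGen.trans hz this)
    have := hS.2 hg' Set.subset_union_left
    exact hx (this (Or.inr Relation.ReflTransGen.refl))
  have dec : ∀ x, x ∈ S ∨ ng x ∈ S := by
    intro x
    by_contra hcon
    push Not at hcon
    by_cases hr : Relation.ReflTransGen (Imp Φ) x (ng x)
    · apply ext (ng x) hcon.2 (by rw [ng_ng]; exact hcon.1)
      rw [ng_ng]
      exact fun hh => h x ⟨hr, hh⟩
    · exact ext x hcon.1 hcon.2 hr
  refine ⟨fun v => decide ((v, true) ∈ S), fun j => ?_⟩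
  have tr : ∀ x : Lt n, x ∈ S → decide ((x.1, true) ∈ S) = x.2 := by
    rintro ⟨v, b⟩ hx
    cases b
    · have := hg.2 _ hx
      simpa [ng] using this
    · simpa using hx
  rcases dec (Φ j).1 with h1 | h1
  · exact Or.inl (tr _ h1)
  · right
    apply tr
    exact hg.1 _ h1 _ (.single ⟨j, by rw [ng_ng]; rfl⟩)

lemma walk_of_reach {α : Type} {R : α → α → Prop} {x y : α} (h : Relation.ReflTransGen R x y) :
    ∃ (k : ℕ) (g : ℕ → α), g 0 = x ∧ g k = y ∧ ∀ i < k, R (g i) (g (i + 1)) := by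
  induction h with
  | refl => exact ⟨0, fun _ => x, rfl, rfl, by simp⟩
  | @tail b c _ hbc ih =>
    obtain ⟨k, g, h0, hk, hg⟩ := ih
    refine ⟨k + 1, fun i => if i ≤ k then g i else c, by simp [h0], by simp, ?_⟩
    intro i hi
    by_cases hik : i < k
    · have h2 : i + 1 ≤ k := hik
      simp only [hik.le, h2, if_true]
      exact hg i hik
    · have : i = k := by omega
      subst this
      simp [hk, hbc]

lemma periodic_walk {α : Type} {R : α → α → Prop} {x y : α} (hxy : x ≠ y)
    (h1 : Relation.ReflTransGen R x y) (h2 : Relation.ReflTransGen R y x) :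
    ∃ (L : ℕ) (f : ℕ → α) (k : ℕ), 0 < L ∧ (∀ i, f (i + L) = f i) ∧ f 0 = x ∧ f k = y ∧
      ∀ i, R (f i) (f (i + 1)) := by
  obtain ⟨k1, g1, a0, a1, a2⟩ := walk_of_reach h1
  obtain ⟨k2, g2, b0, b1, b2⟩ := walk_of_reach h2
  have hk1 : 0 < k1 := by
    rcases Nat.eq_zero_or_pos k1 with h | h
    · subst h; exact absurd (a0.symm.trans a1) hxy
    · exact h
  have hk2 : 0 < k2 := by
    rcases Nat.eq_zero_or_pos k2 with h | h
    · subst h; exact absurd (b1.symm.trans b0) hxy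
    · exact h
  let G : ℕ → α := fun r => if r < k1 then g1 r else g2 (r - k1)
  have hGs : ∀ r, r + 1 < k1 + k2 → R (G r) (G (r + 1)) := by
    intro r hr
    by_cases c1 : r + 1 < k1
    · have : r < k1 := by omega
      simp only [G, c1, this, if_true]
      exact a2 r this
    · by_cases c2 : r < k1
      · have hh : r + 1 = k1 := by omega
        simp only [G, c1, c2, if_true, if_false]
        rw [hh, Nat.sub_self, b0, ← a1, ← hh]
        exact a2 r c2
      · simp only [G, c1, c2, if_false]
        have : r + 1 - k1 = r - k1 + 1 := by omega
        rw [this]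
        exact b2 _ (by omega)
  have hGl : R (G (k1 + k2 - 1)) (G 0) := by
    have c2 : ¬ (k1 + k2 - 1 < k1) := by omega
    simp only [G, c2, hk1, if_true, if_false]
    have := b2 (k2 - 1) (by omega)
    rw [Nat.sub_add_cancel hk2, b1] at this
    rw [a0]
    have e : k1 + k2 - 1 - k1 = k2 - 1 := by omega
    rw [e]
    exact this
  refine ⟨k1 + k2, fun i => G (i % (k1 + k2)), k1, by omega, ?_, ?_, ?_, ?_⟩
  · intro i; simp
  · simp [G, hk1, a0]
  · have : k1 % (k1 + k2) = k1 := Nat.mod_eq_of_lt (by omega)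
    simp [this, G, b0]
  · intro i
    have hlt : i % (k1 + k2) < k1 + k2 := Nat.mod_lt _ (by omega)
    by_cases hc : i % (k1 + k2) + 1 < k1 + k2
    · have : (i + 1) % (k1 + k2) = i % (k1 + k2) + 1 := by
        rw [Nat.add_mod, Nat.mod_eq_of_lt (a := 1) (by omega), Nat.mod_eq_of_lt hc]
      simp only [this]
      exact hGs _ hc
    · have h3 : i % (k1 + k2) = k1 + k2 - 1 := by omega
      have : (i + 1) % (k1 + k2) = 0 := by
        rw [Nat.add_mod, h3, Nat.mod_eq_of_lt (a := 1) (by omega), Nat.sub_add_cancel (by omega),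
          Nat.mod_self]
      simp only [this, h3]
      exact hGl

def Win (f : ℕ → Lt n) (a s : ℕ) : Prop :=
  ∀ i j, i < s → j < s → (f (a + i)).1 = (f (a + j)).1 → i = j

lemma Win.le {f : ℕ → Lt n} {a s : ℕ} (h : Win f a s) : s ≤ n := by
  have : Function.Injective (fun i : Fin s => (f (a + i)).1) := by
    intro i j hij
    exact Fin.ext (h i j i.2 j.2 hij)
  simpa using Fintype.card_le_of_injective _ this

lemma win_exists (f : ℕ → Lt n) (L k : ℕ) (x : Lt n) (hL : 0 < L) (hp : ∀ i, f (i + L) = f i)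
    (h0 : f 0 = x) (hk : f k = ng x) :
    ∃ s a, 0 < a ∧ Win f a s ∧ (∀ b, ¬ Win f b (s + 1)) ∧ f (a + s) ≠ f a := by
  obtain ⟨s, ⟨a, ha⟩, hs⟩ : ∃ s, (∃ a, Win f a s) ∧ ¬ ∃ a, Win f a (s + 1) := by
    by_contra hcon
    push Not at hcon
    have : ∀ s, ∃ a, Win f a s := by
      intro s
      induction s with
      | zero => exact ⟨0, fun i j hi => absurd hi (by omega)⟩
      | succ s ih => exact hcon s ih
    obtain ⟨a, ha⟩ := this (n + 1)
    have := ha.le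
    omega
  push Not at hs
  have hs0 : 0 < s := by
    rcases Nat.eq_zero_or_pos s with h | h
    · subst h
      exact absurd (fun i j hi hj _ => by omega) (hs 0)
    · exact h
  by_contra hcon
  push Not at hcon
  have hpm : ∀ c i, f (i + c * L) = f i := by
    intro c
    induction c with
    | zero => simp
    | succ c ih => intro i; rw [Nat.succ_mul, ← add_assoc, hp, ih]
  have ha' : Win f (a + L) s := by
    intro i j hi hj he
    apply ha i j hi hj
    rw [← hp (a + i), ← hp (a + j)]
    rwa [add_right_comm a i, add_right_comm a j]
  have hall : ∀ t, Win f (a + L + t) s := by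
    intro t
    induction t with
    | zero => exact ha'
    | succ t ih =>
      have hw := hcon s (a + L + t) (by omega) ih hs
      intro i j hi hj he
      by_cases hi1 : i + 1 < s
      · by_cases hj1 : j + 1 < s
        · have := ih (i + 1) (j + 1) hi1 hj1 (by
            rw [show a + L + t + (i + 1) = a + L + (t + 1) + i by ring,
              show a + L + t + (j + 1) = a + L + (t + 1) + j by ring]; exact he)
          omega
        · have hjs : a + L + (t + 1) + j = a + L + t + s := by omega
          rw [hjs, hw] at he
          have := ih (i + 1) 0 hi1 hs0 (by
            rw [show a + L + t + (i + 1) = a + L + (t + 1) + i by ring]; exact he)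
          omega
      · by_cases hj1 : j + 1 < s
        · have his : a + L + (t + 1) + i = a + L + t + s := by omega
          rw [his, hw] at he
          have := ih 0 (j + 1) hs0 hj1 (by
            rw [show a + L + t + (j + 1) = a + L + (t + 1) + j by ring]; exact he)
          omega
        · omega
  have hper : ∀ t, f (a + L + t + s) = f (a + L + t) :=
    fun t => hcon s (a + L + t) (by omega) (hall t) hs
  have hmod : ∀ t, f (a + L + t) = f (a + L + t % s) := by
    intro t
    have : ∀ c r, f (a + L + (r + c * s)) = f (a + L + r) := by
      intro c
      induction c with
      | zero => simp
      | succ c ih =>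
        intro r
        rw [Nat.succ_mul, ← add_assoc r, ← add_assoc (a + L), hper, ih]
    conv_lhs => rw [← Nat.mod_add_div' t s]
    exact this _ _
  have hge : a + L ≤ (a + L) * L := Nat.le_mul_of_pos_right _ hL
  have e1 := hmod ((a + L) * L - (a + L))
  have e2 := hmod (k + (a + L) * L - (a + L))
  rw [Nat.add_sub_cancel' hge, ← zero_add ((a + L) * L), hpm, h0, zero_add] at e1
  rw [Nat.add_sub_cancel' (by omega), hpm, hk] at e2
  have := ha' (((a + L) * L - (a + L)) % s) ((k + (a + L) * L - (a + L)) % s) (Nat.mod_lt _ hs0) (Nat.mod_lt _ hs0) (by rw [← e1, ← e2, ng_fst])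
  rw [this] at e1
  exact ng_ne x (e2.trans e1.symm)

lemma bicycle (Φ : ι → Lt n × Lt n) (hu : ¬ SatG Φ) :
    ∃ s ≤ n, ∃ g : ℕ → Lt n, (∀ i < s + 1, Imp Φ (g i) (g (i + 1))) ∧
      (∀ i j, i < s → j < s → (g (i + 1)).1 = (g (j + 1)).1 → i = j) ∧ g (s + 1) ≠ g 1 ∧
      (∃ i < s, (g 0).1 = (g (i + 1)).1) ∧ (∃ i < s, (g (s + 1)).1 = (g (i + 1)).1) := by
  have : ∃ x, Relation.ReflTransGen (Imp Φ) x (ng x) ∧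
      Relation.ReflTransGen (Imp Φ) (ng x) x := by
    by_contra hcon
    push Not at hcon
    exact hu (sat_of_no_cycle Φ fun x hx => hcon x hx.1 hx.2)
  obtain ⟨x, hx1, hx2⟩ := this
  obtain ⟨L, f, k, hL, hp, h0, hk, hR⟩ := periodic_walk (ng_ne x).symm hx1 hx2
  obtain ⟨s, a, ha, hw, hmax, hne⟩ := win_exists f L k x hL hp h0 hk
  obtain ⟨b, rfl⟩ : ∃ b, a = b + 1 := ⟨a - 1, by omega⟩
  have hw' : ∀ i j, i < s → j < s → (f (b + (i + 1))).1 = (f (b + (j + 1))).1 → i = j := by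
    intro i j hi hj he
    apply hw i j hi hj
    rw [show b + 1 + i = b + (i + 1) by ring, show b + 1 + j = b + (j + 1) by ring]
    exact he
  refine ⟨s, hw.le, fun i => f (b + i), fun i _ => hR (b + i), hw', ?_, ?_, ?_⟩
  · beta_reduce
    rw [show b + (s + 1) = b + 1 + s by ring]
    exact hne
  · by_contra hcon
    push Not at hcon
    apply hmax b
    intro i j hi hj he
    rcases i with _ | i <;> rcases j with _ | j
    · rfl
    · exact absurd he (hcon j (by omega))
    · exact absurd he.symm (hcon i (by omega))
    · rw [hw' i j (by omega) (by omega) he]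
  · by_contra hcon
    push Not at hcon
    apply hmax (b + 1)
    intro i j hi hj he
    rw [show b + 1 + i = b + (i + 1) by ring, show b + 1 + j = b + (j + 1) by ring] at he
    by_cases his : i < s <;> by_cases hjs : j < s
    · exact hw' i j his hjs he
    · have : j = s := by omega
      subst this
      exact absurd he.symm (hcon i his)
    · have : i = s := by omega
      subst this
      exact absurd he (hcon j hjs)
    · omega

abbrev Cfg (n s : ℕ) := (Fin s → Lt n) × (Fin s × Bool) × (Fin s × Bool)

def gd {s : ℕ} (d : Cfg n s) : ℕ → Lt n := fun k =>
  if k = 0 then ((d.1 d.2.1.1).1, d.2.1.2)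
  else if h : k - 1 < s then d.1 ⟨k - 1, h⟩ else ((d.1 d.2.2.1).1, d.2.2.2)

def Pd {s : ℕ} (d : Cfg n s) : Finset (Sym2 (Lt n)) :=
  (Finset.range (s + 1)).image (fun k => s(ng (gd d k), gd d (k + 1)))

lemma cfg_exists (Φ : ι → Lt n × Lt n) (hu : ¬ SatG Φ) :
    ∃ d : (Σ s : Fin (n + 1), Cfg n s), (Pd d.2).card = d.1 + 1 ∧
      ∀ c ∈ Pd d.2, ∃ j, mk2 (Φ j) = c := by
  obtain ⟨s, hs, g, hR, hinj, hne, ⟨i0, hi0, e0⟩, ⟨i1, hi1, e1⟩⟩ := bicycle Φ hu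
  let d : Cfg n s := (fun i => g (i + 1), (⟨i0, hi0⟩, (g 0).2), (⟨i1, hi1⟩, (g (s + 1)).2))
  have hg : ∀ k, k ≤ s + 1 → gd d k = g k := by
    intro k hk
    rcases k with _ | k
    · simp [gd, d, ← e0]
    · by_cases hks : k < s
      · simp [gd, d, hks]
      · have : k = s := by omega
        subst this
        simp [gd, d, ← e1]
  refine ⟨⟨⟨s, by omega⟩, d⟩, ?_, ?_⟩
  · show (Pd d).card = s + 1
    unfold Pd
    rw [Finset.card_image_of_injOn, Finset.card_range]
    have main : ∀ k l, k < l → l ≤ s → s(ng (g k), g (k + 1)) ≠ s(ng (g l), g (l + 1)) := by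
      intro k l hkl hl he
      rw [Sym2.eq_iff] at he
      obtain ⟨l, rfl⟩ : ∃ l', l = l' + 1 := ⟨l - 1, by omega⟩
      rcases he with ⟨h1, h2⟩ | ⟨h1, h2⟩
      · have h1 := ng_inj h1
        rcases k with _ | k
        · by_cases hls : l + 1 < s
          · have := hinj 0 (l + 1) (by omega) hls (by rw [h2])
            omega
          · have : l + 1 = s := by omega
            rw [this] at h2
            exact hne h2.symm
        · have := hinj k l (by omega) (by omega) (by rw [h1])
          omega
      · have := hinj k l (by omega) (by omega) (by rw [h2, ng_fst])
        subst this
        exact ng_ne _ h2.symm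
    intro k hk l hl he
    simp only [Finset.coe_range, Set.mem_Iio] at hk hl
    simp only at he
    rw [hg k (by omega), hg (k + 1) (by omega), hg l (by omega), hg (l + 1) (by omega)] at he
    rcases lt_trichotomy k l with h | h | h
    · exact absurd he (main k l h (by omega))
    · exact h
    · exact absurd he.symm (main l k h (by omega))
  · intro c hc
    simp only [Pd, Finset.mem_image, Finset.mem_range] at hc
    obtain ⟨k, hk, rfl⟩ := hc
    change k < s + 1 at hk
    rw [hg k (by omega), hg (k + 1) (by omega)]
    exact hR k hk

lemma unsat_bound (hn : 2 ≤ n) : Prb n (fun Φ : ι → Lt n × Lt n => ¬ SatG Φ) ≤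
    ∑ s ∈ Finset.range (n + 1), ((2 * n : ℝ) ^ s * (2 * s) ^ 2) *
      (Fintype.card ι * qq n) ^ (s + 1) := by
  have hq := qq_nonneg n
  refine le_trans (Prb_mono fun Φ _ hu => cfg_exists Φ hu) ?_
  refine le_trans (Prb_exists _) ?_
  rw [Fintype.sum_sigma, ← Fin.sum_univ_eq_sum_range (fun s : ℕ => ((2 * n : ℝ) ^ s * (2 * s) ^ 2) *
      (Fintype.card ι * qq n) ^ (s + 1))]
  apply Finset.sum_le_sum
  intro s _
  have hb : ∀ d : Cfg n s, Prb n (fun Φ : ι → Lt n × Lt n => (Pd d).card = s + 1 ∧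
      ∀ c ∈ Pd d, ∃ j, mk2 (Φ j) = c) ≤ (Fintype.card ι * qq n) ^ ((s : ℕ) + 1) := by
    intro d
    by_cases hc : (Pd d).card = s + 1
    · refine le_trans (Prb_mono ?_) (le_trans (Prb_core (ι := ι) hn (Pd d) ∅ (by simp)) ?_)
      · rintro Φ - ⟨-, h⟩
        exact ⟨h, by simp⟩
      · rw [hc]; simp
    · simp only [hc, false_and]
      have : Prb n (fun Φ : ι → Lt n × Lt n => False) = 0 := by simp [Prb]
      rw [this]
      positivity
  refine le_trans (Finset.sum_le_sum fun d _ => hb d) ?_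
  rw [Finset.sum_const, Finset.card_univ, nsmul_eq_mul]
  apply le_of_eq
  congr 1
  simp only [Fintype.card_prod, Fintype.card_fun, Fintype.card_fin, Fintype.card_bool]
  push_cast
  ring
end

lemma lower_part {ε : ℝ} (hε : 0 < ε) (m : ℕ → ℕ)
    (hm : ∀ᶠ n : ℕ in atTop, (m n : ℝ) ≤ (1 - ε) * n) :
    Tendsto (fun n => probSat2 n (m n) fun _ => (n : ℝ)⁻¹) atTop (nhds 1) := by
  obtain ⟨e, he, he1, heε⟩ : ∃ e : ℝ, 0 < e ∧ e ≤ 1 / 2 ∧ e ≤ ε :=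
    ⟨min ε 1 / 2, by positivity, by linarith [min_le_right ε 1],
      by linarith [min_le_left ε 1]⟩
  set r : ℝ := 1 - e / 2 with hr
  have hsum : Summable (fun s : ℕ => (s : ℝ) ^ 2 * r ^ s) :=
    summable_pow_mul_geometric_of_norm_lt_one 2 (by
      rw [Real.norm_eq_abs, abs_lt]; constructor <;> linarith)
  have hlim : Tendsto (fun n : ℕ => (2 * ∑' s : ℕ, (s : ℝ) ^ 2 * r ^ s) * (1 / (n : ℝ))) atTop
      (nhds 0) := by
    have := inv_lim.const_mul (2 * ∑' s : ℕ, (s : ℝ) ^ 2 * r ^ s)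
    rwa [mul_zero] at this
  have hbig : ∀ᶠ n : ℕ in atTop, 2 ≤ e * (n : ℝ) :=
    ((tendsto_natCast_atTop_atTop (R := ℝ)).const_mul_atTop he).eventually_ge_atTop 2
  have hun : Tendsto (fun n => Prb n (fun Φ : Fin (m n) → Lt n × Lt n => ¬ SatG Φ)) atTop
      (nhds 0) := by
    refine squeeze_zero' (Eventually.of_forall fun n => Prb_nonneg _) ?_ hlim
    filter_upwards [eventually_ge_atTop 2, hm, hbig] with n hn hmn hb
    have hn2 : (2 : ℝ) ≤ n := by exact_mod_cast hn
    refine le_trans (unsat_bound hn) ?_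
    rw [Fintype.card_fin]
    have hn1 : (0 : ℝ) < n - 1 := by linarith
    have hrn : (m n : ℝ) / (n - 1) ≤ r := by
      rw [div_le_iff₀ hn1, hr]
      nlinarith
    have hterm : ∀ s : ℕ, ((2 * n : ℝ) ^ s * (2 * s) ^ 2) * (m n * qq n) ^ (s + 1) ≤
        2 * (1 / (n : ℝ)) * ((s : ℝ) ^ 2 * r ^ s) := by
      intro s
      have h1 : ((2 * n : ℝ) ^ s * (2 * s) ^ 2) * (m n * qq n) ^ (s + 1) =
          2 * (1 / (n : ℝ)) * ((s : ℝ) ^ 2 * ((m n : ℝ) / (n - 1)) ^ (s + 1)) := by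
        have h2 : (m n : ℝ) * qq n = (m n / (n - 1)) * (1 / (2 * n)) := by
          unfold qq
          field_simp
        rw [h2, mul_pow ((m n : ℝ) / (n - 1)) (1 / (2 * (n : ℝ))) (s + 1), one_div_pow,
          pow_succ (2 * (n : ℝ)) s]
        have : (2 * (n : ℝ)) ^ s ≠ 0 := by positivity
        generalize (2 * (n : ℝ)) ^ s = A at *
        generalize ((m n : ℝ) / (n - 1)) ^ (s + 1) = B at *
        field_simp
      rw [h1]
      apply mul_le_mul_of_nonneg_left _ (by positivity)
      apply mul_le_mul_of_nonneg_left _ (by positivity)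
      refine le_trans (pow_le_pow_left₀ (by positivity) hrn _) ?_
      apply pow_le_pow_of_le_one <;> first | linarith | omega
    refine le_trans (Finset.sum_le_sum fun s _ => hterm s) ?_
    rw [← Finset.mul_sum]
    have h3 : ∑ s ∈ Finset.range (n + 1), (s : ℝ) ^ 2 * r ^ s ≤ ∑' s : ℕ, (s : ℝ) ^ 2 * r ^ s :=
      hsum.sum_le_tsum _ fun s _ => by
        have : 0 ≤ r := by linarith
        positivity
    calc _ ≤ 2 * (1 / (n : ℝ)) * ∑' s : ℕ, (s : ℝ) ^ 2 * r ^ s :=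
          mul_le_mul_of_nonneg_left h3 (by positivity)
      _ = _ := by ring
  have h1 := (tendsto_const_nhds (x := (1 : ℝ))).sub hun
  rw [sub_zero] at h1
  refine h1.congr' ?_
  filter_upwards [eventually_ge_atTop 2] with n hn
  rw [probSat2_eq hn]
  have := Prb_compl hn (fun Φ : Fin (m n) → Lt n × Lt n => SatG Φ)
  change _ = Prb n (fun Φ : Fin (m n) → Lt n × Lt n => SatG Φ)
  linarith

/-- Uniform random 2-SAT (the ensemble `pᵢ = 1/n`) has a sharp satisfiability threshold
at `m*(n) = n`. -/
theorem uniform_2SAT_sharp_threshold :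
    ∀ ε : ℝ, 0 < ε →
      (∀ m : ℕ → ℕ,
        (∀ᶠ n in atTop, (m n : ℝ) ≤ (1 - ε) * n) →
        Tendsto (fun n => probSat2 n (m n) fun _ => (n : ℝ)⁻¹) atTop (nhds 1)) ∧
      (∀ m : ℕ → ℕ,
        (∀ᶠ n in atTop, (1 + ε) * n ≤ (m n : ℝ)) →
        Tendsto (fun n => probSat2 n (m n) fun _ => (n : ℝ)⁻¹) atTop (nhds 0)) := by
  intro ε hε
  exact ⟨fun m hm => lower_part hε m hm, fun m hm => upper_part hε m hm⟩
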